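/- There is an injective homomorphism χ : Hom(Z, D) → H²(G, D) whose image equals the kernel of θ'; that is, the sequence 0 → Hom(Z, D) → H²(G, D) → H²(H, D) ⊕ H²(K, D) ⊕ Hom(H ⊗ K, D) is exact. In particular, Ker(θ') ≅ Hom(Z, D). -/

import Mathlib

/-!
Setting (central products): `G` is a group with normal subgroups `H` and `K` such that
`G = HK` (i.e. `H ⊔ K = ⊤`) and `[H, K] = 1` (i.e. every element of `H` commutes with
every element of `K`).  We set `A = H ⊓ K` and `Z = ⁅H,H⁆ ⊓ ⁅K,K⁆`; both are central
in `G`.  Coefficients are taken in a divisible abelian group `D`, regarded as a trivial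
module.  Second cohomology `H2 X D` is realized concretely as (inhomogeneous)
2-cocycles modulo 2-coboundaries, and `Hom(X, D)` is realized as `Additive X →+ D`.
-/

open scoped TensorProduct

set_option maxHeartbeats 1000000
set_option synthInstance.maxHeartbeats 1000000
set_option synthInstance.maxSize 2000

namespace SchurCP

variable (G : Type) [Group G] (D : Type) [AddCommGroup D]

/-- The group of 2-cocycles on `G` with values in the trivial module `D`. -/
def cocycles2 : AddSubgroup (G → G → D) where
  carrier := {f | ∀ g h k : G, f g h + f (g * h) k = f h k + f g (h * k)}
  zero_mem' := by intro g h k; simp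
  add_mem' := by
    intro a b ha hb g h k
    simp only [Pi.add_apply]
    rw [add_add_add_comm, ha g h k, hb g h k, add_add_add_comm]
  neg_mem' := by
    intro a ha g h k
    simp only [Pi.neg_apply]
    rw [← neg_add, ← neg_add, ha g h k]

/-- The group of 2-coboundaries on `G` with values in the trivial module `D`. -/
def coboundaries2 : AddSubgroup (G → G → D) where
  carrier := {f | ∃ φ : G → D, ∀ g h : G, f g h = φ g + φ h - φ (g * h)}
  zero_mem' := ⟨0, by simp⟩
  add_mem' := by
    rintro a b ⟨φ, hφ⟩ ⟨ψ, hψ⟩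
    exact ⟨φ + ψ, fun g h => by simp only [Pi.add_apply, hφ g h, hψ g h]; abel⟩
  neg_mem' := by
    rintro a ⟨φ, hφ⟩
    exact ⟨-φ, fun g h => by simp only [Pi.neg_apply, hφ g h]; abel⟩

/-- The second cohomology group `H²(G, D)` of `G` with coefficients in the
trivial module `D`. -/
def H2 : Type := cocycles2 G D ⧸ (coboundaries2 G D).addSubgroupOf (cocycles2 G D)

instance : AddCommGroup (H2 G D) :=
  QuotientAddGroup.Quotient.addCommGroup ((coboundaries2 G D).addSubgroupOf (cocycles2 G D))

variable {G D}

/-- The cohomology class of a 2-cocycle. -/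
abbrev H2mk (f : cocycles2 G D) : H2 G D := QuotientAddGroup.mk f

/-- Pullback of a 2-cocycle along a group homomorphism. -/
def pullCocycle {G' : Type} [Group G'] (π : G' →* G) :
    cocycles2 G D →+ cocycles2 G' D where
  toFun f := ⟨fun x y => (f : G → G → D) (π x) (π y), by
    intro x y z
    simpa only [map_mul] using f.2 (π x) (π y) (π z)⟩
  map_zero' := rfl
  map_add' _ _ := rfl

/-- The homomorphism `H²(G, D) → H²(G', D)` induced by a group homomorphism
`π : G' → G`; this specializes to restriction maps (for inclusions of subgroups)
and to inflation maps (for quotient maps). -/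
def H2Map {G' : Type} [Group G'] (π : G' →* G) : H2 G D →+ H2 G' D :=
  QuotientAddGroup.map _ _ (pullCocycle π) (by
    intro f hf
    rw [AddSubgroup.mem_addSubgroupOf] at hf
    rw [AddSubgroup.mem_comap, AddSubgroup.mem_addSubgroupOf]
    obtain ⟨φ, hφ⟩ := hf
    exact ⟨fun x => φ (π x), fun x y => by
      show (f : G → G → D) (π x) (π y) = _
      rw [hφ (π x) (π y), ← map_mul]⟩)

theorem commutator_le_self {X : Type} [Group X] (H : Subgroup X) : ⁅H, H⁆ ≤ H := by
  rw [Subgroup.commutator_le]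
  intro g₁ h₁ g₂ h₂
  rw [commutatorElement_def]
  exact H.mul_mem (H.mul_mem (H.mul_mem h₁ h₂) (H.inv_mem h₁)) (H.inv_mem h₂)

theorem inf_commutator_le_inf {X : Type} [Group X] (H K : Subgroup X) :
    ⁅H, H⁆ ⊓ ⁅K, K⁆ ≤ H ⊓ K :=
  inf_le_inf (commutator_le_self H) (commutator_le_self K)

theorem subgroupOf_le {X : Type} [Group X] {B C : Subgroup X} (h : B ≤ C)
    (J : Subgroup X) : B.subgroupOf J ≤ C.subgroupOf J := fun _x hx => h hx

/-- The natural projection `X/N → X/M` for `N ≤ M`. -/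
def quotProj {X : Type} [Group X] {N M : Subgroup X} [N.Normal] [M.Normal] (h : N ≤ M) :
    (X ⧸ N) →* (X ⧸ M) :=
  QuotientGroup.map N M (MonoidHom.id X) (by rwa [Subgroup.comap_id])

/-- The inflation homomorphism `H²(X/M, D) → H²(X/N, D)` for `N ≤ M`. -/
def inflMap {X : Type} [Group X] {N M : Subgroup X} [N.Normal] [M.Normal]
    (h : N ≤ M) (D : Type) [AddCommGroup D] : H2 (X ⧸ M) D →+ H2 (X ⧸ N) D :=
  H2Map (quotProj h)

/-- The natural homomorphism `H/(A ∩ H) → X/A` for subgroups `A, H` of `X`;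
for `A ≤ H` this realizes `H/A` as a subgroup of `X/A`. -/
def quotInclusion {X : Type} [Group X] (H A : Subgroup X) [A.Normal]
    [(A.subgroupOf H).Normal] : (↥H ⧸ A.subgroupOf H) →* X ⧸ A :=
  QuotientGroup.map (A.subgroupOf H) A H.subtype (fun _x hx => hx)

/-- The abelian tensor product `X ⊗ Y = X/[X,X] ⊗_ℤ Y/[Y,Y]` of two groups. -/
abbrev AbTensor (X Y : Type) [Group X] [Group Y] : Type :=
  TensorProduct ℤ (Additive (Abelianization X)) (Additive (Abelianization Y))

/-- The element `x[X,X] ⊗ y[Y,Y]` of the abelian tensor product. -/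
noncomputable abbrev tmulAb {X Y : Type} [Group X] [Group Y] (x : X) (y : Y) :
    AbTensor X Y :=
  Additive.ofMul (Abelianization.of x) ⊗ₜ[ℤ] Additive.ofMul (Abelianization.of y)

/-- The map on abelian tensor products induced by a pair of group homomorphisms. -/
noncomputable def abTensorMap {X Y X' Y' : Type} [Group X] [Group Y] [Group X'] [Group Y']
    (f : X →* X') (g : Y →* Y') : AbTensor X Y →ₗ[ℤ] AbTensor X' Y' :=
  TensorProduct.map (MonoidHom.toAdditive (Abelianization.map f)).toIntLinearMap
    (MonoidHom.toAdditive (Abelianization.map g)).toIntLinearMap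

theorem H2mk_eq_zero_iff (f : cocycles2 G D) :
    H2mk f = 0 ↔ ∃ φ : G → D, ∀ g h : G, (f : G → G → D) g h = φ g + φ h - φ (g * h) :=
  QuotientAddGroup.eq_zero_iff f

section Transgression

variable {P : Type} [Group P] {π : P →* G} (hπ : Function.Surjective π)

/-- The kernel component of `x : P` relative to the chosen section of the surjection `π`. -/
noncomputable def kerPart (x : P) : π.ker :=
  ⟨x * (Function.surjInv hπ (π x))⁻¹, by
    simp [MonoidHom.mem_ker, Function.surjInv_eq hπ]⟩

theorem kerPart_mul_surjInv (x : P) : (kerPart hπ x : P) * Function.surjInv hπ (π x) = x :=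
  inv_mul_cancel_right _ _

theorem kerPart_surjInv (g : G) : kerPart hπ (Function.surjInv hπ g) = 1 := by
  ext
  simp [kerPart, Function.surjInv_eq hπ]

theorem kerPart_mul (hN : π.ker ≤ Subgroup.center P) (x y : P) :
    kerPart hπ (x * y) = kerPart hπ x * kerPart hπ y *
      kerPart hπ (Function.surjInv hπ (π x) * Function.surjInv hπ (π y)) := by
  have hy := Subgroup.mem_center_iff.1 (hN (kerPart hπ y).2) (Function.surjInv hπ (π x))
  ext
  simp only [kerPart, Subgroup.coe_mul, map_mul, Function.surjInv_eq hπ] at hy ⊢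
  calc x * y * (Function.surjInv hπ (π x * π y))⁻¹
      = x * (Function.surjInv hπ (π x))⁻¹ *
          (Function.surjInv hπ (π x) * (y * (Function.surjInv hπ (π y))⁻¹)) *
          (Function.surjInv hπ (π y) * (Function.surjInv hπ (π x * π y))⁻¹) := by group
    _ = _ := by rw [hy]; group

theorem map_kerPart_mul (hN : π.ker ≤ Subgroup.center P) (α : Additive π.ker →+ D) (x y : P) :
    α (.ofMul (kerPart hπ (x * y))) = α (.ofMul (kerPart hπ x)) + α (.ofMul (kerPart hπ y)) +
      α (.ofMul (kerPart hπ (Function.surjInv hπ (π x) * Function.surjInv hπ (π y)))) := by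
  rw [kerPart_mul hπ hN, ofMul_mul, ofMul_mul, map_add, map_add]

/-- The 2-cocycle obtained by applying `α` to the factor set of a central extension. -/
noncomputable def transgressionCocycle (hN : π.ker ≤ Subgroup.center P) :
    (Additive π.ker →+ D) →+ cocycles2 G D where
  toFun α := ⟨fun g h =>
    α (.ofMul (kerPart hπ (Function.surjInv hπ g * Function.surjInv hπ h))), by
      intro g h k
      have h₁ := map_kerPart_mul hπ hN α (Function.surjInv hπ g * Function.surjInv hπ h)
        (Function.surjInv hπ k)
      have h₂ := map_kerPart_mul hπ hN α (Function.surjInv hπ g)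
        (Function.surjInv hπ h * Function.surjInv hπ k)
      simp only [map_mul, Function.surjInv_eq hπ, kerPart_surjInv, ofMul_one, map_zero,
        add_zero, zero_add] at h₁ h₂
      rw [← h₁, ← h₂, mul_assoc]⟩
  map_zero' := rfl
  map_add' _ _ := rfl

/-- The transgression `Hom(ker π, D) → H²(G, D)` of a central extension `π : P → G`. -/
noncomputable def transgression (hN : π.ker ≤ Subgroup.center P) :
    (Additive π.ker →+ D) →+ H2 G D :=
  (QuotientAddGroup.mk' ((coboundaries2 G D).addSubgroupOf (cocycles2 G D))).comp
    (transgressionCocycle hπ hN)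

theorem transgression_eq_zero_iff (hN : π.ker ≤ Subgroup.center P) (α : Additive π.ker →+ D) :
    transgression hπ hN α = 0 ↔
      ∃ β : Additive P →+ D, ∀ n : π.ker, β (.ofMul (n : P)) = α (.ofMul n) := by
  refine (H2mk_eq_zero_iff (transgressionCocycle hπ hN α)).trans ⟨?_, ?_⟩
  · rintro ⟨φ, hφ⟩
    change ∀ g h, α (.ofMul (kerPart hπ (Function.surjInv hπ g * Function.surjInv hπ h))) = _ at hφ
    refine ⟨AddMonoidHom.mk' (fun x => α (.ofMul (kerPart hπ x.toMul)) + φ (π x.toMul)) ?_, ?_⟩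
    · intro x y
      rw [toMul_add, map_kerPart_mul hπ hN, hφ, map_mul]
      abel
    · intro n
      have h₁ := hφ 1 1
      have hn : (n : P) = kerPart hπ (n : P) * Function.surjInv hπ 1 := by
        conv_lhs => rw [← kerPart_mul_surjInv hπ (n : P), show π n = 1 from n.2]
      have h₂ : π (Function.surjInv hπ 1) = 1 := Function.surjInv_eq hπ 1
      have h₃ : n = kerPart hπ (n : P) * ⟨Function.surjInv hπ 1, h₂⟩ := Subtype.ext hn
      have h₄ : kerPart hπ (Function.surjInv hπ 1 * Function.surjInv hπ 1) =
          ⟨Function.surjInv hπ 1, h₂⟩ := by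
        ext
        simp [kerPart, h₂]
      rw [h₄, mul_one, add_sub_cancel_right] at h₁
      change α (.ofMul (kerPart hπ (n : P))) + φ (π n) = _
      conv_rhs => rw [h₃, ofMul_mul, map_add, h₁]
      rw [show π n = 1 from n.2]
  · rintro ⟨β, hβ⟩
    refine ⟨fun g => β (.ofMul (Function.surjInv hπ g)), fun g h => ?_⟩
    change α (.ofMul (kerPart hπ (Function.surjInv hπ g * Function.surjInv hπ h))) = _
    rw [← hβ]
    simp [kerPart, Function.surjInv_eq hπ, sub_eq_add_neg]

theorem H2Map_eq_zero_iff_mem_range_transgression (hN : π.ker ≤ Subgroup.center P)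
    (ξ : H2 G D) : H2Map π ξ = 0 ↔ ξ ∈ Set.range (transgression hπ hN (D := D)) := by
  constructor
  · obtain ⟨f, rfl⟩ := QuotientAddGroup.mk_surjective ξ
    intro h
    obtain ⟨Φ, hΦ⟩ := (H2mk_eq_zero_iff (pullCocycle π f)).1 h
    change ∀ x y, (f : G → G → D) (π x) (π y) = _ at hΦ
    have hf : ∀ g, (f : G → G → D) 1 g = (f : G → G → D) 1 1 := fun g => by
      have := f.2 1 1 g
      simpa [eq_comm] using this
    have hmul : ∀ (n : π.ker) (y : P),
        Φ (n * y) = Φ n + Φ y - (f : G → G → D) 1 1 := fun n y => by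
      have := hΦ n y
      rw [show π n = 1 from n.2, hf] at this
      rw [this]
      abel
    refine ⟨AddMonoidHom.mk' (fun n => (f : G → G → D) 1 1 - Φ (n.toMul : P)) ?_, ?_⟩
    · intro n m
      rw [toMul_add, Subgroup.coe_mul, hmul]
      abel
    · refine (sub_eq_zero.1 ?_).symm
      refine (H2mk_eq_zero_iff (f - transgressionCocycle hπ hN _)).2
        ⟨fun g => Φ (Function.surjInv hπ g), fun g h => ?_⟩
      change (f : G → G → D) g h - ((f : G → G → D) 1 1 -
        Φ (kerPart hπ (Function.surjInv hπ g * Function.surjInv hπ h))) = _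
      have h₁ := hmul (kerPart hπ (Function.surjInv hπ g * Function.surjInv hπ h))
        (Function.surjInv hπ (g * h))
      have h₂ := kerPart_mul_surjInv hπ (Function.surjInv hπ g * Function.surjInv hπ h)
      have h₃ := hΦ (Function.surjInv hπ g) (Function.surjInv hπ h)
      simp only [map_mul, Function.surjInv_eq hπ] at h₂ h₃
      rw [h₂] at h₁
      rw [h₃, h₁]
      abel
  · rintro ⟨α, rfl⟩
    refine (H2mk_eq_zero_iff (pullCocycle π (transgressionCocycle hπ hN α))).2
      ⟨fun x => -α (.ofMul (kerPart hπ x)), fun x y => ?_⟩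
    change α (.ofMul (kerPart hπ (Function.surjInv hπ (π x) * Function.surjInv hπ (π y)))) = _
    beta_reduce
    rw [map_kerPart_mul hπ hN α x y]
    abel

end Transgression

/-- Homomorphisms into a divisible abelian group extend along maps to commutative groups. -/
theorem exists_extension_of_divisible [DivisibleBy D ℤ] {M Q : Type} [Group M] [Group Q]
    (hQ : ∀ x y : Q, x * y = y * x) (f : M →* Q) (α : Additive M →+ D)
    (hα : ∀ m, f m = 1 → α (.ofMul m) = 0) :
    ∃ β : Additive Q →+ D, ∀ m, β (.ofMul (f m)) = α (.ofMul m) := by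
  let _ : CommGroup Q := { (inferInstance : Group Q) with mul_comm := hQ }
  let r : Additive M →+ f.toAdditive.range := f.toAdditive.rangeRestrict
  have hr : Function.Surjective r := f.toAdditive.rangeRestrict_surjective
  have hker : r.ker ≤ α.ker := fun m hm => hα m.toMul (congrArg Subtype.val hm)
  obtain ⟨β, hβ⟩ := (Module.Baer.of_divisible D).extension_property_addMonoidHom
    f.toAdditive.range.subtype Subtype.val_injective (r.liftOfSurjective hr ⟨α, hker⟩)
  refine ⟨β, fun m => ?_⟩
  refine (DFunLike.congr_fun hβ (r (.ofMul m))).trans ?_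
  exact AddMonoidHom.liftOfRightInverse_comp_apply r _ _ ⟨α, hker⟩ (.ofMul m)

section CentralProduct

variable {H K : Subgroup G} (hcomm : ∀ h ∈ H, ∀ k ∈ K, Commute h k)

/-- The multiplication map `H × K → G` of two commuting subgroups. -/
def centralProductMap : H × K →* G :=
  H.subtype.noncommCoprod K.subtype fun h k => hcomm h h.2 k k.2

theorem centralProductMap_apply (p : H × K) : centralProductMap hcomm p = (p.1 : G) * p.2 := rfl

theorem centralProductMap_surjective [K.Normal] (hprod : H ⊔ K = ⊤) :
    Function.Surjective (centralProductMap hcomm) := fun g => by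
  have hg : g ∈ H ⊔ K := hprod ▸ Subgroup.mem_top g
  obtain ⟨h, hh, k, hk, rfl⟩ := Subgroup.mem_sup_of_normal_right.1 hg
  exact ⟨(⟨h, hh⟩, ⟨k, hk⟩), rfl⟩

theorem ker_centralProductMap_le_center :
    (centralProductMap hcomm).ker ≤ Subgroup.center (H × K) := by
  rintro ⟨a, b⟩ hab
  have hab' : (a : G) * b = 1 := hab
  have ha : (a : G) = (b : G)⁻¹ := eq_inv_of_mul_eq_one_left hab'
  have hb : (b : G) = (a : G)⁻¹ := eq_inv_of_mul_eq_one_right hab'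
  rw [Subgroup.mem_center_iff]
  rintro ⟨h, k⟩
  refine Prod.ext (Subtype.ext ?_) (Subtype.ext ?_)
  · change (h : G) * a = a * h
    rw [ha]
    exact (hcomm h h.2 _ b.2).inv_right
  · change (k : G) * b = b * k
    rw [hb]
    exact (hcomm _ a.2 k k.2).symm.inv_right

theorem H2Map_centralProductMap_eq_zero_iff
    (ν : H2 G D →+ (AbTensor ↥H ↥K →+ D))
    (hν : ∀ f : cocycles2 G D, ∀ (h : ↥H) (k : ↥K),
      ν (H2mk f) (tmulAb h k) = (f : G → G → D) ↑h ↑k - (f : G → G → D) ↑k ↑h)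
    (ξ : H2 G D) :
    H2Map (centralProductMap hcomm) ξ = 0 ↔
      H2Map H.subtype ξ = 0 ∧ H2Map K.subtype ξ = 0 ∧ ν ξ = 0 := by
  obtain ⟨f, rfl⟩ := QuotientAddGroup.mk_surjective ξ
  constructor
  · intro h
    obtain ⟨Φ, hΦ⟩ := (H2mk_eq_zero_iff (pullCocycle (centralProductMap hcomm) f)).1 h
    change ∀ x y : H × K, (f : G → G → D) ((x.1 : G) * x.2) ((y.1 : G) * y.2) = _ at hΦ
    refine ⟨(H2mk_eq_zero_iff (pullCocycle H.subtype f)).2 ⟨fun h => Φ (h, 1), fun g h => ?_⟩,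
      (H2mk_eq_zero_iff (pullCocycle K.subtype f)).2 ⟨fun k => Φ (1, k), fun g h => ?_⟩, ?_⟩
    · change (f : G → G → D) g h = _
      simpa using hΦ (g, 1) (h, 1)
    · change (f : G → G → D) g h = _
      simpa using hΦ (1, g) (1, h)
    · ext t
      induction t using TensorProduct.induction_on with
      | zero => simp
      | add x y hx hy => rw [map_add, map_add, hx, hy]
      | tmul x y =>
        obtain ⟨h, rfl⟩ := QuotientGroup.mk_surjective (s := commutator H) x
        obtain ⟨k, rfl⟩ := QuotientGroup.mk_surjective (s := commutator K) y
        refine (hν f h k).trans ?_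
        have h₁ := hΦ (h, 1) (1, k)
        have h₂ := hΦ (1, k) (h, 1)
        simp only [OneMemClass.coe_one, one_mul, mul_one, Prod.mk_mul_mk] at h₁ h₂
        rw [h₁, h₂, add_comm (Φ (1, k)), sub_self, AddMonoidHom.zero_apply]
  · rintro ⟨hH, hK, hνf⟩
    obtain ⟨φ, hφ⟩ := (H2mk_eq_zero_iff (pullCocycle H.subtype f)).1 hH
    obtain ⟨ψ, hψ⟩ := (H2mk_eq_zero_iff (pullCocycle K.subtype f)).1 hK
    change ∀ g h : H, (f : G → G → D) g h = _ at hφ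
    change ∀ g h : K, (f : G → G → D) g h = _ at hψ
    have hsymm : ∀ (h : H) (k : K), (f : G → G → D) h k = (f : G → G → D) k h := fun h k => by
      rw [← sub_eq_zero, ← hν, show ν (H2mk f) = 0 from hνf, AddMonoidHom.zero_apply]
    refine (H2mk_eq_zero_iff (pullCocycle (centralProductMap hcomm) f)).2
      ⟨fun p => φ p.1 + ψ p.2 - (f : G → G → D) p.1 p.2, ?_⟩
    rintro ⟨h, k⟩ ⟨h', k'⟩
    change (f : G → G → D) ((h : G) * k) ((h' : G) * k') = φ h + ψ k - (f : G → G → D) h k +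
      (φ h' + ψ k' - (f : G → G → D) h' k') -
      (φ (h * h') + ψ (k * k') - (f : G → G → D) ((h : G) * h') ((k : G) * k'))
    have e : (k : G) * h' = h' * k := (hcomm h' h'.2 k k.2).symm
    have h₁ := f.2 ((h : G) * k) h' k'
    have h₂ := f.2 (h : G) k h'
    have h₃ := f.2 (h : G) h' k
    have h₄ := f.2 ((h : G) * h') k k'
    rw [mul_assoc, e, ← mul_assoc] at h₁
    rw [e, ← hsymm] at h₂
    have h₅ := hφ h h'
    have h₆ := hψ k k'
    grind

/-- The antidiagonal embedding of `[H, H] ∩ [K, K]` into the kernel of `H × K → G`. -/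
def antidiagonal :
    ↥(⁅H, H⁆ ⊓ ⁅K, K⁆) →* (centralProductMap hcomm).ker where
  toFun z := ⟨(⟨z, commutator_le_self H z.2.1⟩, ⟨z, commutator_le_self K z.2.2⟩⁻¹), by
    simp [MonoidHom.mem_ker, centralProductMap_apply]⟩
  map_one' := by ext <;> simp
  map_mul' x y := by
    have := hcomm x (commutator_le_self H x.2.1) y (commutator_le_self K y.2.2)
    ext
    · simp
    · simp [this.eq]

theorem antidiagonal_injective : Function.Injective (antidiagonal hcomm) := fun x y h => by
  have := congrArg (fun n : (centralProductMap hcomm).ker => (n.1.1 : G)) h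
  exact Subtype.ext this

theorem abelianization_of_eq_one_iff {X : Type} [Group X] {L : Subgroup X} (x : L) :
    Abelianization.of x = 1 ↔ (x : X) ∈ ⁅L, L⁆ := by
  rw [← MonoidHom.mem_ker, Abelianization.ker_of, ← L.map_subtype_commutator]
  exact (Subgroup.mem_map_iff_mem L.subtype_injective).symm

theorem map_eq_zero_of_mem_commutator {X : Type} [Group X] {L : Subgroup X}
    (β : Additive L →+ D) (x : L) (hx : (x : X) ∈ ⁅L, L⁆) : β (.ofMul x) = 0 := by
  have h := congrArg (Abelianization.lift (AddMonoidHom.toMultiplicativeRight β))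
    ((abelianization_of_eq_one_iff x).2 hx)
  simpa using h

theorem exists_extension_iff_comp_antidiagonal_eq_zero [DivisibleBy D ℤ]
    (α : Additive (centralProductMap hcomm).ker →+ D) :
    (∃ β : Additive (H × K) →+ D,
      ∀ n : (centralProductMap hcomm).ker, β (.ofMul (n : H × K)) = α (.ofMul n)) ↔
      α.comp (antidiagonal hcomm).toAdditive = 0 := by
  constructor
  · rintro ⟨β, hβ⟩
    ext z
    change α (.ofMul (antidiagonal hcomm z)) = 0
    rw [← hβ]
    have h₁ := map_eq_zero_of_mem_commutator (β.comp (MonoidHom.inl H K).toAdditive)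
      (antidiagonal hcomm z).1.1 z.2.1
    have h₂ := map_eq_zero_of_mem_commutator (β.comp (MonoidHom.inr H K).toAdditive)
      (antidiagonal hcomm z).1.2 (inv_mem z.2.2)
    rw [← Prod.fst_mul_snd (antidiagonal hcomm z).1, ofMul_mul, map_add]
    exact (congrArg₂ (· + ·) h₁ h₂).trans (add_zero 0)
  · intro h
    obtain ⟨β, hβ⟩ := exists_extension_of_divisible mul_comm
      (Abelianization.of.comp (centralProductMap hcomm).ker.subtype) α (by
        rintro ⟨⟨a, b⟩, hn⟩ hab
        have hab' : Abelianization.of (a, b) = 1 := hab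
        have ha := congrArg (Abelianization.map (MonoidHom.fst H K)) hab'
        have hb := congrArg (Abelianization.map (MonoidHom.snd H K)) hab'
        rw [Abelianization.map_of, map_one] at ha hb
        have ha' := (abelianization_of_eq_one_iff a).1 ha
        have hb' := (abelianization_of_eq_one_iff b).1 hb
        have hba : (b : G) = (a : G)⁻¹ := eq_inv_of_mul_eq_one_right hn
        have haK : (a : G) ∈ ⁅K, K⁆ := by
          rw [hba] at hb'
          exact inv_mem_iff.1 hb'
        have hz : (⟨(a, b), hn⟩ : (centralProductMap hcomm).ker) =
            antidiagonal hcomm ⟨a, ha', haK⟩ := by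
          refine Subtype.ext (Prod.ext rfl (Subtype.ext hba))
        rw [hz]
        exact DFunLike.congr_fun h (Additive.ofMul ⟨(a : G), ha', haK⟩))
    exact ⟨β.comp Abelianization.of.toAdditive, hβ⟩

theorem comp_antidiagonal_surjective [DivisibleBy D ℤ] :
    Function.Surjective
      (AddMonoidHom.compHom' (P := D) (antidiagonal hcomm).toAdditive) := fun γ => by
  obtain ⟨β, hβ⟩ := exists_extension_of_divisible
    (fun x y => Subtype.ext <|
      (Subgroup.mem_center_iff.1 (ker_centralProductMap_le_center hcomm y.2) x))
    (antidiagonal hcomm) γ (fun m hm => by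
      rw [(antidiagonal_injective hcomm) (hm.trans (map_one _).symm), ofMul_one, map_zero])
  exact ⟨β, DFunLike.ext _ _ fun z => hβ z.toMul⟩

end CentralProduct

/-- The sequence `0 → Hom(Z, D) → H²(G, D) → H²(H, D) ⊕ H²(K, D) ⊕ Hom(H ⊗ K, D)`
is exact: there is an injective homomorphism `χ : Hom(Z, D) → H²(G, D)` whose image is
exactly the kernel of `θ' = (res, res, ν)`.  In particular `Ker θ' ≅ Hom(Z, D)`. -/
theorem exact_homZ_H2 {G : Type} [Group G] (H K : Subgroup G) [H.Normal] [K.Normal]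
    (hprod : H ⊔ K = ⊤) (hcomm : ∀ h ∈ H, ∀ k ∈ K, Commute h k)
    (D : Type) [AddCommGroup D] [DivisibleBy D ℤ]
    (ν : H2 G D →+ (AbTensor ↥H ↥K →+ D))
    (hν : ∀ f : cocycles2 G D, ∀ (h : ↥H) (k : ↥K),
      ν (H2mk f) (tmulAb h k) = (f : G → G → D) ↑h ↑k - (f : G → G → D) ↑k ↑h) :
    ∃ χ : (Additive ↥(⁅H, H⁆ ⊓ ⁅K, K⁆) →+ D) →+ H2 G D,
      Function.Injective χ ∧
      ∀ ξ : H2 G D,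
        (H2Map H.subtype ξ = 0 ∧ H2Map K.subtype ξ = 0 ∧ ν ξ = 0) ↔ ξ ∈ Set.range χ := by
  have hπ := centralProductMap_surjective hcomm hprod
  have hN := ker_centralProductMap_le_center hcomm
  let r := AddMonoidHom.compHom' (P := D) (antidiagonal hcomm).toAdditive
  have hr : Function.Surjective r := comp_antidiagonal_surjective hcomm
  have hτ : ∀ α, transgression hπ hN α = 0 ↔ r α = 0 := fun α =>
    (transgression_eq_zero_iff hπ hN α).trans
      (exists_extension_iff_comp_antidiagonal_eq_zero hcomm α)
  let χ := r.liftOfSurjective hr ⟨transgression hπ hN, fun α hα => (hτ α).2 hα⟩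
  have hχ : ∀ α, χ (r α) = transgression hπ hN α :=
    AddMonoidHom.liftOfRightInverse_comp_apply r _ _ _
  refine ⟨χ, (injective_iff_map_eq_zero χ).2 fun γ hγ => ?_, fun ξ => ?_⟩
  · obtain ⟨α, rfl⟩ := hr γ
    exact (hτ α).1 ((hχ α).symm.trans hγ)
  · rw [← H2Map_centralProductMap_eq_zero_iff hcomm ν hν,
      H2Map_eq_zero_iff_mem_range_transgression hπ hN, ← hr.range_comp χ]
    exact Iff.of_eq (congrArg (ξ ∈ Set.range ·) (funext fun α => (hχ α).symm))

end SchurCP
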